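/- There exists a constant C₂ > 0 such that for all real x₁, x₂ with x₂ − x₁ > 0: ‖ U̇(H_{0,1}(·−x₂) + H_{-1,0}(·−x₁)) − U̇(H_{0,1}(·−x₂)) − U̇(H_{-1,0}(·−x₁)) ‖_{L²(ℝ)} ≤ C₂·e^{−√2(x₂−x₁)}. (Equivalently, since each kink is a critical point of E_pot, the L² norm of the Fréchet derivative DE_pot(H_{0,1}(·−x₂)+H_{-1,0}(·−x₁)) is at most C₂·e^{−√2(x₂−x₁)}.) -/

import Mathlib

noncomputable section

open MeasureTheory Real

/-- The φ⁶ kink `H_{0,1}(x) = e^{√2 x} / (1 + e^{2√2 x})^{1/2}`. -/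
def H01 (x : ℝ) : ℝ := Real.exp (Real.sqrt 2 * x) / Real.sqrt (1 + Real.exp (2 * Real.sqrt 2 * x))

/-- The reflected kink `H_{-1,0}(x) = -H_{0,1}(-x)`. -/
def Hm10 (x : ℝ) : ℝ := - H01 (-x)

/-- The φ⁶ potential `U(φ) = φ²(1-φ²)²`. -/
def U (p : ℝ) : ℝ := p ^ 2 * (1 - p ^ 2) ^ 2

/-- `U̇(φ) = 2φ - 8φ³ + 6φ⁵`. -/
def Udot (p : ℝ) : ℝ := 2 * p - 8 * p ^ 3 + 6 * p ^ 5

/-- `Ü(φ) = 2 - 24φ² + 30φ⁴`. -/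
def Uddot (p : ℝ) : ℝ := 2 - 24 * p ^ 2 + 30 * p ^ 4

/-- `U⁽³⁾(φ) = -48φ + 120φ³`. -/
def U3 (p : ℝ) : ℝ := -48 * p + 120 * p ^ 3

/-- The `L²` norm of a real function, as `√(∫ f²)`. -/
def L2norm (f : ℝ → ℝ) : ℝ := Real.sqrt (∫ x : ℝ, f x ^ 2)

/-- The `H¹` norm of a real function, as `√(∫ f² + f'²)`. -/
def H1norm (f : ℝ → ℝ) : ℝ := Real.sqrt (∫ x : ℝ, (f x ^ 2 + deriv f x ^ 2))

/-- Square integrability. -/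
def InL2 (f : ℝ → ℝ) : Prop := Integrable (fun x : ℝ => f x ^ 2)

/-- Membership in `H¹(ℝ)`. -/
def InH1 (f : ℝ → ℝ) : Prop := InL2 f ∧ InL2 (deriv f)

/-- The potential energy `E_pot(φ) = ∫ (1/2) φ'² + U(φ)`. -/
def Epot (f : ℝ → ℝ) : ℝ := ∫ x : ℝ, ((1 / 2) * deriv f x ^ 2 + U (f x))

theorem H01_pos (x : ℝ) : 0 < H01 x := by
  unfold H01
  positivity

theorem H01_le_exp (x : ℝ) : H01 x ≤ Real.exp (Real.sqrt 2 * x) := by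
  unfold H01
  refine div_le_self (Real.exp_pos _).le (Real.one_le_sqrt.mpr ?_)
  linarith [Real.exp_pos (2 * Real.sqrt 2 * x)]

theorem H01_le_one (x : ℝ) : H01 x ≤ 1 := by
  unfold H01
  rw [div_le_one (by positivity)]
  refine Real.le_sqrt_of_sq_le ?_
  rw [← Real.exp_nat_mul]
  push_cast
  rw [← mul_assoc]
  linarith

/-- A kink squared times an opposite kink decays away from the centre of the former. -/
theorem H01_sq_mul_le (y z : ℝ) :
    H01 y ^ 2 * H01 z ≤ Real.exp (Real.sqrt 2 * (y + z)) * Real.exp (-(Real.sqrt 2 * |y|)) := by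
  rw [← Real.exp_add]
  have hy := H01_pos y
  have hz := H01_pos z
  rcases abs_cases y with ⟨h, -⟩ | ⟨h, -⟩ <;> rw [h]
  · calc H01 y ^ 2 * H01 z ≤ 1 * Real.exp (Real.sqrt 2 * z) :=
          mul_le_mul (pow_le_one₀ hy.le (H01_le_one y)) (H01_le_exp z) hz.le zero_le_one
      _ = _ := by rw [one_mul]; congr 1; ring
  · calc H01 y ^ 2 * H01 z
        ≤ Real.exp (Real.sqrt 2 * y) ^ 2 * Real.exp (Real.sqrt 2 * z) :=
          mul_le_mul (pow_le_pow_left₀ hy.le (H01_le_exp y) 2) (H01_le_exp z) hz.le (by positivity)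
      _ = _ := by
        rw [← Real.exp_nat_mul, ← Real.exp_add]
        congr 1
        push_cast
        ring

theorem exp_neg_sqrt_two_mul_abs_sq_le (y : ℝ) :
    Real.exp (-(Real.sqrt 2 * |y|)) ^ 2 ≤ (1 + y ^ 2)⁻¹ := by
  rw [Real.exp_neg, inv_pow]
  refine inv_anti₀ (by positivity) ?_
  have h1 := Real.add_one_le_exp (Real.sqrt 2 * |y|)
  have h2 : 0 ≤ Real.sqrt 2 * |y| := by positivity
  have h3 : (Real.sqrt 2 * |y|) ^ 2 = 2 * y ^ 2 := by
    rw [mul_pow, Real.sq_sqrt zero_le_two, sq_abs]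
  nlinarith [pow_le_pow_left₀ (by linarith) h1 2, sq_nonneg y]

/-- The interaction term `U̇(a - b) - U̇(a) - U̇(-b)` is of third order in `a, b ∈ [0, 1]`. -/
theorem abs_Udot_sub_le {a b : ℝ} (ha : 0 ≤ a) (ha' : a ≤ 1) (hb : 0 ≤ b) (hb' : b ≤ 1) :
    |Udot (a + -b) - Udot a - Udot (-b)| ≤ 90 * (a ^ 2 * b + b ^ 2 * a) := by
  have key : Udot (a + -b) - Udot a - Udot (-b)
      = (a * b) * ((a - b) * (24 - 30 * (a ^ 2 - a * b + b ^ 2))) := by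
    unfold Udot; ring
  have h1 : |a - b| ≤ a + b := abs_le.mpr ⟨by linarith, by linarith⟩
  have h2 : |24 - 30 * (a ^ 2 - a * b + b ^ 2)| ≤ 90 := by
    have := mul_nonneg ha hb
    rw [abs_le]
    constructor <;> nlinarith [sq_nonneg (a - b)]
  rw [key, abs_mul, abs_of_nonneg (mul_nonneg ha hb), abs_mul]
  calc a * b * (|a - b| * |24 - 30 * (a ^ 2 - a * b + b ^ 2)|)
      ≤ a * b * ((a + b) * 90) := by gcongr
    _ = _ := by ring

theorem Udot_kinks_sq_le (x x1 x2 : ℝ) :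
    (Udot (H01 (x - x2) + Hm10 (x - x1)) - Udot (H01 (x - x2)) - Udot (Hm10 (x - x1))) ^ 2 ≤
      16200 * Real.exp (-(Real.sqrt 2) * (x2 - x1)) ^ 2 *
        ((1 + (x - x2) ^ 2)⁻¹ + (1 + (x - x1) ^ 2)⁻¹) := by
  have h := abs_Udot_sub_le (H01_pos (x - x2)).le (H01_le_one _) (H01_pos (-(x - x1))).le
    (H01_le_one _)
  have h1 := H01_sq_mul_le (x - x2) (-(x - x1))
  have h2 := H01_sq_mul_le (-(x - x1)) (x - x2)
  have e1 : Real.sqrt 2 * (x - x2 + -(x - x1)) = -(Real.sqrt 2) * (x2 - x1) := by ring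
  have e2 : Real.sqrt 2 * (-(x - x1) + (x - x2)) = -(Real.sqrt 2) * (x2 - x1) := by ring
  rw [e1] at h1
  rw [e2, abs_neg] at h2
  have g1 := exp_neg_sqrt_two_mul_abs_sq_le (x - x2)
  have g2 := exp_neg_sqrt_two_mul_abs_sq_le (x - x1)
  unfold Hm10
  set ε := Real.exp (-(Real.sqrt 2) * (x2 - x1))
  set p := Real.exp (-(Real.sqrt 2 * |x - x2|))
  set q := Real.exp (-(Real.sqrt 2 * |x - x1|))
  have hle := h.trans (show _ ≤ 90 * (ε * p + ε * q) by gcongr)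
  rw [← sq_abs]
  calc _ ≤ (90 * (ε * p + ε * q)) ^ 2 := pow_le_pow_left₀ (abs_nonneg _) hle 2
    _ = 8100 * ε ^ 2 * (p + q) ^ 2 := by ring
    _ ≤ 8100 * ε ^ 2 * (2 * (p ^ 2 + q ^ 2)) := by gcongr; exact add_sq_le
    _ ≤ 8100 * ε ^ 2 * (2 * ((1 + (x - x2) ^ 2)⁻¹ + (1 + (x - x1) ^ 2)⁻¹)) := by gcongr
    _ = _ := by ring

/-- `L²` bound on the Fréchet derivative of `E_pot` at a sum of two separated kinks. -/
theorem DEpot_L2_bound :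
    ∃ C2 > (0:ℝ), ∀ x1 x2 : ℝ, x2 - x1 > 0 →
      L2norm (fun x =>
          Udot (H01 (x - x2) + Hm10 (x - x1)) - Udot (H01 (x - x2)) - Udot (Hm10 (x - x1))) ≤
        C2 * Real.exp (-(Real.sqrt 2) * (x2 - x1)) := by
  refine ⟨180 * Real.sqrt π, by positivity, fun x1 x2 _ => ?_⟩
  have hint (c : ℝ) : Integrable fun x : ℝ => (1 + (x - c) ^ 2)⁻¹ :=
    integrable_inv_one_add_sq.comp_sub_right c
  have hval (c : ℝ) : ∫ x : ℝ, (1 + (x - c) ^ 2)⁻¹ = π := by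
    rw [integral_sub_right_eq_self (fun x : ℝ => (1 + x ^ 2)⁻¹) c]
    exact integral_univ_inv_one_add_sq
  refine Real.sqrt_le_iff.mpr ⟨by positivity, ?_⟩
  refine (integral_mono_of_nonneg (ae_of_all _ fun x => sq_nonneg _)
    (((hint x2).add (hint x1)).const_mul _)
    (ae_of_all _ fun x => Udot_kinks_sq_le x x1 x2)).trans_eq ?_
  simp only [Pi.add_apply]
  rw [integral_const_mul, integral_add (hint x2) (hint x1), hval, hval, mul_pow, mul_pow,
    Real.sq_sqrt Real.pi_pos.le]
  ring
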